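/- Let Γ be an Abelian group of order 2n and suppose ℓ is a Γ-distance magic labeling of GP(n,2). Then for every i ∈ Z_n: ℓ(y_i) + ℓ(y_{i+5}) = ℓ(y_{i+3}) + ℓ(y_{i+8}) and ℓ(x_i) + ℓ(x_{i+5}) = ℓ(x_{i+3}) + ℓ(x_{i+8}). -/

import Mathlib

open Finset

noncomputable def vertexWeight {V Γ : Type*} [Fintype V] [AddCommMonoid Γ]
    (G : SimpleGraph V) (ℓ : V → Γ) (x : V) : Γ := by
  classical exact ∑ y ∈ Finset.univ.filter (fun v => G.Adj x v), ℓ y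

/-- `ℓ` is a distance magic labeling of `G` with magic constant `μ`. -/
def IsDistMagic {V Γ : Type*} [Fintype V] [AddCommMonoid Γ]
    (G : SimpleGraph V) (ℓ : V → Γ) (μ : Γ) : Prop :=
  Function.Bijective ℓ ∧ ∀ x, vertexWeight G ℓ x = μ

noncomputable def degOf {V : Type*} [Fintype V] (G : SimpleGraph V) (v : V) : ℕ := by
  classical exact (Finset.univ.filter (fun u => G.Adj v u)).card

/-- The generalized Petersen graph `GP(n,k)` on vertex set `ZMod n ⊕ ZMod n`:
`Sum.inl i` is the outer vertex `x_i`, `Sum.inr i` the inner vertex `y_i`. -/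
def GP (n k : ℕ) : SimpleGraph (ZMod n ⊕ ZMod n) :=
  SimpleGraph.fromRel (fun a b =>
    match a, b with
    | Sum.inl i, Sum.inl j => j = i + 1
    | Sum.inr i, Sum.inr j => j = i + (k : ZMod n)
    | Sum.inl i, Sum.inr j => i = j
    | _, _ => False)

/-- A balanced zero-neighborhood labeling of a graph `G` on `2n` vertices. -/
noncomputable def IsBZN {V : Type*} [Fintype V] (G : SimpleGraph V) (n : ℕ)
    (ℓ : V → ZMod 2) : Prop := by
  classical exact
    (Finset.univ.filter (fun v => ℓ v = 0)).card = n ∧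
    (Finset.univ.filter (fun v => ℓ v = 1)).card = n ∧
    ∀ v, vertexWeight G ℓ v = 0

theorem vertexWeight_eq_sum {V Γ : Type*} [Fintype V] [AddCommMonoid Γ]
    (G : SimpleGraph V) (ℓ : V → Γ) (x : V) (s : Finset V) (h : ∀ v, G.Adj x v ↔ v ∈ s) :
    vertexWeight G ℓ x = ∑ y ∈ s, ℓ y := by
  classical
  unfold vertexWeight
  congr 1
  ext v
  simp [h]

theorem GP_adj_inl_inl {n k : ℕ} {i j : ZMod n} :
    (GP n k).Adj (Sum.inl i) (Sum.inl j) ↔ i ≠ j ∧ (j = i + 1 ∨ i = j + 1) := by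
  simp [GP]

theorem GP_adj_inr_inr {n k : ℕ} {i j : ZMod n} :
    (GP n k).Adj (Sum.inr i) (Sum.inr j) ↔ i ≠ j ∧ (j = i + k ∨ i = j + k) := by
  simp [GP]

theorem GP_adj_inl_inr {n k : ℕ} {i j : ZMod n} :
    (GP n k).Adj (Sum.inl i) (Sum.inr j) ↔ i = j := by
  simp [GP]

theorem GP_adj_inr_inl {n k : ℕ} {i j : ZMod n} :
    (GP n k).Adj (Sum.inr i) (Sum.inl j) ↔ i = j := by
  simp [GP, eq_comm]

theorem vertexWeight_GP_inl {Γ : Type*} [AddCommMonoid Γ] {n k : ℕ} [NeZero n]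
    (h2 : (2 : ZMod n) ≠ 0) (ℓ : ZMod n ⊕ ZMod n → Γ) (i : ZMod n) :
    vertexWeight (GP n k) ℓ (Sum.inl (i + 1)) =
      ℓ (Sum.inl i) + (ℓ (Sum.inl (i + 2)) + ℓ (Sum.inr (i + 1))) := by
  have h1 : (1 : ZMod n) ≠ 0 := fun h => h2 (by linear_combination 2 * h)
  rw [vertexWeight_eq_sum _ ℓ _ {Sum.inl i, Sum.inl (i + 2), Sum.inr (i + 1)}]
  · rw [sum_insert, sum_insert, sum_singleton] <;> simp [h2]
  · rintro (j | j)
    · simp only [GP_adj_inl_inl, mem_insert, mem_singleton, Sum.inl.injEq, reduceCtorEq, or_false]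
      grind
    · simp [GP_adj_inl_inr, eq_comm]

theorem vertexWeight_GP_two_inr {Γ : Type*} [AddCommMonoid Γ] {n : ℕ} [NeZero n]
    (h4 : (4 : ZMod n) ≠ 0) (ℓ : ZMod n ⊕ ZMod n → Γ) (i : ZMod n) :
    vertexWeight (GP n 2) ℓ (Sum.inr (i + 2)) =
      ℓ (Sum.inr i) + (ℓ (Sum.inr (i + 4)) + ℓ (Sum.inl (i + 2))) := by
  have h2 : (2 : ZMod n) ≠ 0 := fun h => h4 (by linear_combination 2 * h)
  rw [vertexWeight_eq_sum _ ℓ _ {Sum.inr i, Sum.inr (i + 4), Sum.inl (i + 2)}]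
  · rw [sum_insert, sum_insert, sum_singleton] <;> simp [h4]
  · rintro (j | j)
    · simp [GP_adj_inr_inl, eq_comm]
    · simp only [GP_adj_inr_inr, mem_insert, mem_singleton, Sum.inr.injEq, reduceCtorEq, or_false,
        Nat.cast_ofNat]
      grind

theorem not_isDistMagic_GP_two_of_four_eq_zero {Γ : Type*} [AddCommGroup Γ] {n : ℕ} [NeZero n]
    (h2 : (2 : ZMod n) ≠ 0) (h4 : (4 : ZMod n) = 0) (ℓ : ZMod n ⊕ ZMod n → Γ) (μ : Γ) :
    ¬ IsDistMagic (GP n 2) ℓ μ := by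
  rintro ⟨hbij, hw⟩
  have hx (j : ZMod n) := (vertexWeight_GP_inl h2 ℓ j).symm.trans (hw _)
  have key : ℓ (Sum.inr 1) = ℓ (Sum.inr 3) := by
    have e0 := hx 0
    have e2 := hx 2
    have h22 : (2 + 2 : ZMod n) = 0 := by linear_combination h4
    have h21 : (2 + 1 : ZMod n) = 3 := by norm_num
    rw [zero_add, zero_add] at e0
    rw [h22, h21] at e2
    linear_combination (norm := abel) e0 - e2
  have h13 := Sum.inr.inj (hbij.1 key)
  exact h2 (by linear_combination -h13)

theorem add_eq_add_of_GP_two_weights {Γ : Type*} [AddCommGroup Γ] {n : ℕ}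
    (x y : ZMod n → Γ) (μ : Γ) (hx : ∀ j, x j + (x (j + 2) + y (j + 1)) = μ)
    (hy : ∀ j, y j + (y (j + 4) + x (j + 2)) = μ) (i : ZMod n) :
    y i + y (i + 5) = y (i + 3) + y (i + 8) ∧ x i + x (i + 5) = x (i + 3) + x (i + 8) := by
  have hx' (a b c : ZMod n) (hb : b = a + 2) (hc : c = a + 1) : x a + (x b + y c) = μ := by
    rw [hb, hc]; exact hx a
  have hy' (a b c : ZMod n) (hb : b = a + 4) (hc : c = a + 2) : y a + (y b + x c) = μ := by
    rw [hb, hc]; exact hy a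
  have Y (j : ZMod n) : y j + y (j + 2) + y (j + 4) + y (j + 6) - y (j + 3) = μ := by
    have a := hy' j (j + 4) (j + 2) (by ring) (by ring)
    have b := hy' (j + 2) (j + 6) (j + 4) (by ring) (by ring)
    have c := hx' (j + 2) (j + 4) (j + 3) (by ring) (by ring)
    linear_combination (norm := abel) a + b - c
  have X (j : ZMod n) : x j + x (j + 2) + x (j + 4) + x (j + 6) - x (j + 3) = μ := by
    have a := hx' j (j + 2) (j + 1) (by ring) (by ring)
    have b := hx' (j + 4) (j + 6) (j + 5) (by ring) (by ring)
    have c := hy' (j + 1) (j + 5) (j + 3) (by ring) (by ring)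
    linear_combination (norm := abel) a + b - c
  constructor
  · have a := Y i
    have b := Y (i + 2)
    simp only [add_assoc i] at b
    norm_num at b
    linear_combination (norm := abel) a - b
  · have a := X i
    have b := X (i + 2)
    simp only [add_assoc i] at b
    norm_num at b
    linear_combination (norm := abel) a - b

theorem stmt15 {Γ : Type*} [AddCommGroup Γ] [Fintype Γ]
    (n : ℕ) [NeZero n] (hcard : Fintype.card Γ = 2 * n)
    (ℓ : ZMod n ⊕ ZMod n → Γ) (μ : Γ) (hmagic : IsDistMagic (GP n 2) ℓ μ)
    (i : ZMod n) :
    ℓ (Sum.inr i) + ℓ (Sum.inr (i + 5)) = ℓ (Sum.inr (i + 3)) + ℓ (Sum.inr (i + 8)) ∧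
    ℓ (Sum.inl i) + ℓ (Sum.inl (i + 5)) = ℓ (Sum.inl (i + 3)) + ℓ (Sum.inl (i + 8)) := by
  by_cases h2 : (2 : ZMod n) = 0
  · have h5 : i + 5 = i + 3 := by linear_combination h2
    have h8 : i + 8 = i := by linear_combination 4 * h2
    rw [h5, h8]
    exact ⟨add_comm _ _, add_comm _ _⟩
  by_cases h4 : (4 : ZMod n) = 0
  · exact absurd hmagic (not_isDistMagic_GP_two_of_four_eq_zero h2 h4 ℓ μ)
  exact add_eq_add_of_GP_two_weights (fun j => ℓ (Sum.inl j)) (fun j => ℓ (Sum.inr j)) μ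
    (fun j => (vertexWeight_GP_inl h2 ℓ j).symm.trans (hmagic.2 _))
    (fun j => (vertexWeight_GP_two_inr h4 ℓ j).symm.trans (hmagic.2 _)) i
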